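/- There exists a constant C depending only on α and d (in particular independent of ν, T, a and u) such that, defining ũ(t,x) = u(t,x) − (G_{νt} * u(0,·))(x) for 0 < t < T and ũ(0,x) = 0, one has |ũ(t,x) − ũ(s,x)| ≤ C M₀^α M₁ (t − s)^α for all x ∈ ℝ^d and all 0 ≤ s ≤ t < T. -/

import Mathlib

open MeasureTheory Set

noncomputable def heatKernel (d : ℕ) (s : ℝ) (y : EuclideanSpace ℝ (Fin d)) : ℝ :=
  (4 * Real.pi * s) ^ (-(d : ℝ) / 2) * Real.exp (-(‖y‖ ^ 2) / (4 * s))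

open scoped SchwartzMap ContDiff

lemma one_add_pow_mul_exp_neg_sq_le (m : ℕ) {r : ℝ} (hr : 0 ≤ r) :
    (1 + r) ^ m * Real.exp (-(r ^ 2) / 4) ≤ m.factorial * Real.exp 2 := by
  have h1 := Real.pow_div_factorial_le_exp (1 + r) (by linarith) m
  rw [div_le_iff₀ (by positivity)] at h1
  calc (1 + r) ^ m * Real.exp (-(r ^ 2) / 4)
      ≤ Real.exp (1 + r) * m.factorial * Real.exp (-(r ^ 2) / 4) := by gcongr
    _ = m.factorial * Real.exp (1 + r + -(r ^ 2) / 4) := by rw [Real.exp_add (1 + r)]; ring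
    _ ≤ m.factorial * Real.exp 2 := by
        gcongr
        nlinarith [sq_nonneg (r - 2)]

lemma exists_norm_pow_mul_iteratedFDeriv_gaussian_le {V : Type*} [NormedAddCommGroup V]
    [InnerProductSpace ℝ V] (k n : ℕ) :
    ∃ C : ℝ, ∀ x : V,
      ‖x‖ ^ k * ‖iteratedFDeriv ℝ n (fun y : V => Real.exp (-(‖y‖ ^ 2) / 4)) x‖ ≤ C := by
  have hq : (fun y : V => -(‖y‖ ^ 2) / 4).HasTemperateGrowth := by
    have : (fun y : V => -(‖y‖ ^ 2) / 4) = fun y : V => (-1 / 4 : ℝ) * (‖y‖ ^ 2) := by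
      ext y; ring
    rw [this]
    fun_prop
  obtain ⟨l, C, hC, hbd⟩ := hq.norm_iteratedFDeriv_le_uniform n
  refine ⟨n.factorial * (1 + C) ^ n * ((k + l * n).factorial * Real.exp 2), fun x => ?_⟩
  have hx : 1 ≤ 1 + ‖x‖ := by linarith [norm_nonneg x]
  have key := norm_iteratedFDeriv_comp_le (𝕜 := ℝ) (g := Real.exp)
    (f := fun y : V => -(‖y‖ ^ 2) / 4) (n := n) (N := n) Real.contDiff_exp (hq.1.of_le (by
      exact_mod_cast le_top)) le_rfl x (C := Real.exp (-(‖x‖ ^ 2) / 4))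
    (D := (1 + C) * (1 + ‖x‖) ^ l)
    (fun i _ => by
      rw [norm_iteratedFDeriv_eq_norm_iteratedDeriv, iteratedDeriv_eq_iterate]
      simp [Real.iter_deriv_exp])
    (fun i h1 hi => by
      refine (hbd i hi x).trans ?_
      have h2 : 1 ≤ (1 + C) * (1 + ‖x‖) ^ l :=
        one_le_mul_of_one_le_of_one_le (by linarith) (one_le_pow₀ hx)
      calc C * (1 + ‖x‖) ^ l ≤ (1 + C) * (1 + ‖x‖) ^ l := by gcongr; linarith
        _ ≤ _ := le_self_pow₀ h2 (by omega))
  have e : (fun y : V => Real.exp (-(‖y‖ ^ 2) / 4)) = Real.exp ∘ fun y : V => -(‖y‖ ^ 2) / 4 := rfl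
  rw [e]
  calc _ ≤ (1 + ‖x‖) ^ k * (n.factorial * Real.exp (-(‖x‖ ^ 2) / 4) *
        ((1 + C) * (1 + ‖x‖) ^ l) ^ n) := by
        gcongr
        linarith
    _ = n.factorial * (1 + C) ^ n * ((1 + ‖x‖) ^ (k + l * n) * Real.exp (-(‖x‖ ^ 2) / 4)) := by
        rw [mul_pow, pow_add, pow_mul]; ring
    _ ≤ _ := mul_le_mul_of_nonneg_left
        (one_add_pow_mul_exp_neg_sq_le _ (norm_nonneg x)) (by positivity)

/-- The heat kernel at time one, as a Schwartz function. -/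
noncomputable def unitHeatKernel (d : ℕ) : 𝓢(EuclideanSpace ℝ (Fin d), ℝ) :=
  ((4 * Real.pi) ^ (-(d : ℝ) / 2) : ℝ) •
    { toFun := fun y => Real.exp (-(‖y‖ ^ 2) / 4)
      smooth' := ((contDiff_norm_sq ℝ).neg.div_const 4).exp
      decay' := exists_norm_pow_mul_iteratedFDeriv_gaussian_le }

lemma unitHeatKernel_apply (d : ℕ) (y : EuclideanSpace ℝ (Fin d)) :
    unitHeatKernel d y = (4 * Real.pi) ^ (-(d : ℝ) / 2) * Real.exp (-(‖y‖ ^ 2) / 4) := rfl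

lemma integral_unitHeatKernel (d : ℕ) : ∫ y, unitHeatKernel d y = 1 := by
  simp_rw [unitHeatKernel_apply]
  rw [integral_const_mul]
  have := GaussianFourier.integral_rexp_neg_mul_sq_norm (V := EuclideanSpace ℝ (Fin d))
    (b := 1 / 4) (by norm_num)
  have e : ∀ v : EuclideanSpace ℝ (Fin d), -(1 / 4 : ℝ) * ‖v‖ ^ 2 = -(‖v‖ ^ 2) / 4 := by
    intro v; ring
  simp_rw [e] at this
  rw [this, finrank_euclideanSpace_fin, show Real.pi / (1 / 4) = 4 * Real.pi by ring,
    ← Real.rpow_add (by positivity)]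
  ring_nf
  simp

lemma heatKernel_smul (d : ℕ) {l : ℝ} (hl : 0 < l) (z : EuclideanSpace ℝ (Fin d)) :
    l ^ d * heatKernel d (l ^ 2) (-(l • z)) = unitHeatKernel d z := by
  rw [unitHeatKernel_apply, heatKernel, norm_neg, norm_smul, Real.norm_of_nonneg hl.le,
    Real.mul_rpow (by positivity) (by positivity), ← Real.rpow_natCast l 2, ← Real.rpow_mul hl.le,
    ← Real.rpow_natCast l d]
  have h1 : l ^ (d : ℝ) * l ^ (((2 : ℕ) : ℝ) * (-(d : ℝ) / 2)) = 1 := by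
    rw [← Real.rpow_add hl]
    push_cast
    ring_nf
    simp
  have h2 : -(l * ‖z‖) ^ 2 / (4 * l ^ ((2 : ℕ) : ℝ)) = -(‖z‖ ^ 2) / 4 := by
    rw [Real.rpow_natCast]; field_simp
  rw [h2]
  linear_combination ((4 * Real.pi) ^ (-(d : ℝ) / 2) * Real.exp (-(‖z‖ ^ 2) / 4)) * h1

/-- Convolution with the heat kernel at time `l ^ 2`, after rescaling. -/
lemma integral_heatKernel_smul {d : ℕ} {F : Type*} [NormedAddCommGroup F] [NormedSpace ℝ F]
    {l : ℝ} (hl : 0 < l) (g : EuclideanSpace ℝ (Fin d) → F) (x : EuclideanSpace ℝ (Fin d)) :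
    ∫ y, heatKernel d (l ^ 2) y • g (x - y) = ∫ z, unitHeatKernel d z • g (x + l • z) := by
  have h := Measure.integral_comp_smul (volume : Measure (EuclideanSpace ℝ (Fin d)))
    (fun y => heatKernel d (l ^ 2) y • g (x - y)) (-l)
  have h2 : |((-l) ^ d)⁻¹| = (l ^ d)⁻¹ := by
    rw [abs_inv, abs_pow, abs_neg, abs_of_pos hl]
  rw [finrank_euclideanSpace_fin, h2, eq_inv_smul_iff₀ (by positivity), ← integral_smul] at h
  rw [← h]
  congr with z
  rw [← heatKernel_smul d hl, smul_smul, neg_smul, sub_neg_eq_add]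

lemma lineDerivOp_unitHeatKernel (d : ℕ) (i : Fin d) (z : EuclideanSpace ℝ (Fin d)) :
    fderiv ℝ (unitHeatKernel d) z (EuclideanSpace.single i 1) =
      -(z i / 2) * unitHeatKernel d z := by
  have h1 : HasFDerivAt (fun y : EuclideanSpace ℝ (Fin d) => ‖y‖ ^ 2) (2 • innerSL ℝ z) z :=
    (hasStrictFDerivAt_norm_sq z).hasFDerivAt
  have h2 : HasFDerivAt (fun y : EuclideanSpace ℝ (Fin d) => -(‖y‖ ^ 2) / 4)
      ((-1 / 4 : ℝ) • (2 • innerSL ℝ z)) z := by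
    convert! h1.const_mul (-1 / 4 : ℝ) using 1
    ext y; ring
  have h3 := (h2.exp).const_mul ((4 * Real.pi) ^ (-(d : ℝ) / 2))
  have h4 : HasFDerivAt (unitHeatKernel d) _ z := h3
  rw [h4.fderiv]
  simp [unitHeatKernel_apply, EuclideanSpace.inner_single_right]
  ring

/-- The lattice vector with integer coordinates `n`. -/
noncomputable def latticeVec {d : ℕ} (n : Fin d → ℤ) : EuclideanSpace ℝ (Fin d) :=
  (EuclideanSpace.equiv (Fin d) ℝ).symm (fun i => (n i : ℝ))

lemma isCompact_unitCube (d : ℕ) :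
    IsCompact {x : EuclideanSpace ℝ (Fin d) | ∀ i, x i ∈ Icc (0 : ℝ) 1} := by
  have h := (isCompact_univ_pi fun _ : Fin d => isCompact_Icc (a := (0 : ℝ)) (b := 1)).image
    (EuclideanSpace.equiv (Fin d) ℝ).symm.continuous
  convert h using 1
  ext x
  constructor
  · intro hx
    exact ⟨EuclideanSpace.equiv (Fin d) ℝ x, fun i _ => hx i, by simp⟩
  · rintro ⟨y, hy, rfl⟩ i
    exact hy i trivial

lemma exists_add_latticeVec_mem_unitCube {d : ℕ} (x : EuclideanSpace ℝ (Fin d)) :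
    ∃ n : Fin d → ℤ, ∀ i, (x + latticeVec n) i ∈ Icc (0 : ℝ) 1 := by
  refine ⟨fun i => -⌊x i⌋, fun i => ?_⟩
  have h : (x + latticeVec fun i => -⌊x i⌋) i = Int.fract (x i) := by
    simp [latticeVec, Int.fract, sub_eq_add_neg]
  rw [h]
  exact ⟨Int.fract_nonneg _, (Int.fract_lt_one _).le⟩

lemma exists_norm_le_of_continuousOn_of_periodic {d : ℕ} {F : Type*} [NormedAddCommGroup F]
    {J : Set ℝ} (hJ : IsCompact J) {f : ℝ × EuclideanSpace ℝ (Fin d) → F}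
    (hf : ContinuousOn f (J ×ˢ univ))
    (hper : ∀ r ∈ J, ∀ x n, f (r, x + latticeVec n) = f (r, x)) :
    ∃ C : ℝ, 0 ≤ C ∧ ∀ r ∈ J, ∀ x, ‖f (r, x)‖ ≤ C := by
  obtain ⟨C, hC⟩ := (hJ.prod (isCompact_unitCube d)).exists_bound_of_continuousOn
    (hf.mono (prod_mono_right (subset_univ _)))
  refine ⟨max C 0, le_max_right _ _, fun r hr x => ?_⟩
  obtain ⟨n, hn⟩ := exists_add_latticeVec_mem_unitCube x
  rw [← hper r hr x n]
  exact (hC (r, x + latticeVec n) (mk_mem_prod hr hn)).trans (le_max_left _ _)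

/-- The `i`-th partial derivative. -/
noncomputable def partialD {d : ℕ} (i : Fin d) (g : EuclideanSpace ℝ (Fin d) → ℝ)
    (x : EuclideanSpace ℝ (Fin d)) : ℝ :=
  fderiv ℝ g x (EuclideanSpace.single i 1)

lemma partialD_const {d : ℕ} (i : Fin d) (c : ℝ) :
    partialD i (fun _ : EuclideanSpace ℝ (Fin d) => c) = fun _ => 0 := by
  ext x
  simp [partialD]

/-- Smooth lattice-periodic functions. -/
structure SmoothPeriodic {d : ℕ} (g : EuclideanSpace ℝ (Fin d) → ℝ) : Prop where
  smooth : ContDiff ℝ ∞ g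
  periodic : ∀ x n, g (x + latticeVec n) = g x

namespace SmoothPeriodic

variable {d : ℕ} {g h : EuclideanSpace ℝ (Fin d) → ℝ}

lemma differentiable (hg : SmoothPeriodic g) : Differentiable ℝ g :=
  hg.smooth.differentiable (by simp)

lemma continuous (hg : SmoothPeriodic g) : Continuous g := hg.smooth.continuous

lemma deriv (hg : SmoothPeriodic g) (i : Fin d) : SmoothPeriodic (partialD i g) where
  smooth := (hg.smooth.fderiv_right (m := ∞) (by simp)).clm_apply contDiff_const
  periodic x n := by
    have : (fun y => g (y + latticeVec n)) = g := funext fun y => hg.periodic y n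
    unfold partialD
    rw [← fderiv_comp_add_right, this]

lemma const (c : ℝ) : SmoothPeriodic (fun _ : EuclideanSpace ℝ (Fin d) => c) :=
  ⟨contDiff_const, fun _ _ => rfl⟩

lemma neg (hg : SmoothPeriodic g) : SmoothPeriodic (fun x => -g x) :=
  ⟨hg.smooth.neg, fun x n => by rw [hg.periodic]⟩

lemma add (hg : SmoothPeriodic g) (hh : SmoothPeriodic h) : SmoothPeriodic (fun x => g x + h x) :=
  ⟨hg.smooth.add hh.smooth, fun x n => by rw [hg.periodic, hh.periodic]⟩

lemma sub (hg : SmoothPeriodic g) (hh : SmoothPeriodic h) : SmoothPeriodic (fun x => g x - h x) :=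
  ⟨hg.smooth.sub hh.smooth, fun x n => by rw [hg.periodic, hh.periodic]⟩

lemma mul (hg : SmoothPeriodic g) (hh : SmoothPeriodic h) : SmoothPeriodic (fun x => g x * h x) :=
  ⟨hg.smooth.mul hh.smooth, fun x n => by rw [hg.periodic, hh.periodic]⟩

lemma sum {ι : Type*} {s : Finset ι} {f : ι → EuclideanSpace ℝ (Fin d) → ℝ}
    (hf : ∀ i ∈ s, SmoothPeriodic (f i)) : SmoothPeriodic (fun x => ∑ i ∈ s, f i x) :=
  ⟨ContDiff.sum fun i hi => (hf i hi).smooth,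
    fun x n => Finset.sum_congr rfl fun i hi => (hf i hi).periodic x n⟩

lemma exists_bound (hg : SmoothPeriodic g) : ∃ C : ℝ, 0 ≤ C ∧ ∀ x, |g x| ≤ C := by
  obtain ⟨C, hC, h⟩ := exists_norm_le_of_continuousOn_of_periodic (isCompact_singleton (x := (0 : ℝ)))
    (f := fun q => g q.2) (hg.continuous.comp continuous_snd).continuousOn
    (fun _ _ x n => hg.periodic x n)
  exact ⟨C, hC, fun x => h 0 rfl x⟩

lemma partialD_sum {ι : Type*} {s : Finset ι} {f : ι → EuclideanSpace ℝ (Fin d) → ℝ}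
    (hf : ∀ i ∈ s, SmoothPeriodic (f i)) (j : Fin d) :
    partialD j (fun x => ∑ i ∈ s, f i x) = fun x => ∑ i ∈ s, partialD j (f i) x := by
  ext x
  unfold partialD
  rw [fderiv_fun_sum fun i hi => (hf i hi).differentiable x]
  simp

lemma partialD_neg (j : Fin d) :
    partialD j (fun x => -g x) = fun x => -partialD j g x := by
  ext x
  simp [partialD]

lemma partialD_add (hg : SmoothPeriodic g) (hh : SmoothPeriodic h) (j : Fin d) :
    partialD j (fun x => g x + h x) =
      fun x => partialD j g x + partialD j h x := by
  ext x
  unfold partialD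
  rw [fderiv_fun_add (hg.differentiable x) (hh.differentiable x)]
  simp

lemma partialD_sub (hg : SmoothPeriodic g) (hh : SmoothPeriodic h) (j : Fin d) :
    partialD j (fun x => g x - h x) =
      fun x => partialD j g x - partialD j h x := by
  ext x
  unfold partialD
  rw [fderiv_fun_sub (hg.differentiable x) (hh.differentiable x)]
  simp

lemma partialD_mul (hg : SmoothPeriodic g) (hh : SmoothPeriodic h) (j : Fin d) :
    partialD j (fun x => g x * h x) =
      fun x => partialD j g x * h x + g x * partialD j h x := by
  ext x
  unfold partialD
  rw [fderiv_fun_mul (hg.differentiable x) (hh.differentiable x)]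
  simp
  ring

lemma partialD_comm (hg : SmoothPeriodic g) (i j : Fin d) :
    partialD i (partialD j g) = partialD j (partialD i g) := by
  ext x
  have hd : DifferentiableAt ℝ (fderiv ℝ g) x :=
    (hg.smooth.fderiv_right (m := ∞) (by simp)).differentiable (by simp) x
  have key : ∀ a b : Fin d, partialD a (partialD b g) x =
      fderiv ℝ (fderiv ℝ g) x (EuclideanSpace.single a 1) (EuclideanSpace.single b 1) := by
    intro a b
    change fderiv ℝ (fun y => fderiv ℝ g y (EuclideanSpace.single b 1)) x _ = _
    rw [fderiv_clm_apply hd (differentiableAt_const _)]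
    simp
  rw [key, key]
  exact (hg.smooth.contDiffAt.isSymmSndFDerivAt (n := ∞) (by
    rw [minSmoothness_of_isRCLikeNormedField]
    exact WithTop.coe_le_coe.2 (le_top (a := (2 : ℕ∞))))) _ _

end SmoothPeriodic

/-- The average of `g` around `x` at scale `l` with Schwartz weight `W`. -/
noncomputable def schwartzAvg {d : ℕ} (W : 𝓢(EuclideanSpace ℝ (Fin d), ℝ)) (l : ℝ)
    (g : EuclideanSpace ℝ (Fin d) → ℝ) (x : EuclideanSpace ℝ (Fin d)) : ℝ :=
  ∫ z, W z * g (x + l • z)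

section schwartzAvg

variable {d : ℕ} (W : 𝓢(EuclideanSpace ℝ (Fin d), ℝ)) {l : ℝ} {g h : EuclideanSpace ℝ (Fin d) → ℝ}

lemma integrable_schwartz_mul_of_bounded {g : EuclideanSpace ℝ (Fin d) → ℝ} (hg : Continuous g)
    {C : ℝ} (hC : ∀ x, |g x| ≤ C) (x : EuclideanSpace ℝ (Fin d)) (l : ℝ) :
    Integrable (fun z => W z * g (x + l • z)) :=
  W.integrable.mul_bdd (c := C) (by fun_prop) (.of_forall fun z => hC _)

lemma SmoothPeriodic.integrable_schwartz_mul (hg : SmoothPeriodic g)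
    (x : EuclideanSpace ℝ (Fin d)) (l : ℝ) : Integrable (fun z => W z * g (x + l • z)) := by
  obtain ⟨C, -, hC⟩ := hg.exists_bound
  exact integrable_schwartz_mul_of_bounded W hg.continuous hC x l

lemma schwartzAvg_add (hg : SmoothPeriodic g) (hh : SmoothPeriodic h) (l : ℝ)
    (x : EuclideanSpace ℝ (Fin d)) :
    schwartzAvg W l (fun y => g y + h y) x = schwartzAvg W l g x + schwartzAvg W l h x := by
  unfold schwartzAvg
  rw [← integral_add (hg.integrable_schwartz_mul W x l) (hh.integrable_schwartz_mul W x l)]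
  simp_rw [mul_add]

lemma schwartzAvg_neg (l : ℝ) (g : EuclideanSpace ℝ (Fin d) → ℝ) (x : EuclideanSpace ℝ (Fin d)) :
    schwartzAvg W l (fun y => -g y) x = -schwartzAvg W l g x := by
  unfold schwartzAvg
  rw [← integral_neg]
  simp_rw [mul_neg]

lemma schwartzAvg_sum {ι : Type*} {s : Finset ι} {f : ι → EuclideanSpace ℝ (Fin d) → ℝ}
    (hf : ∀ i ∈ s, SmoothPeriodic (f i)) (l : ℝ) (x : EuclideanSpace ℝ (Fin d)) :
    schwartzAvg W l (fun y => ∑ i ∈ s, f i y) x = ∑ i ∈ s, schwartzAvg W l (f i) x := by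
  unfold schwartzAvg
  rw [← integral_finsetSum _ fun i hi => (hf i hi).integrable_schwartz_mul W x l]
  simp_rw [Finset.mul_sum]

/-- The derivative of a Schwartz function along a basis vector. -/
noncomputable def schwartzD (i : Fin d) (W : 𝓢(EuclideanSpace ℝ (Fin d), ℝ)) :
    𝓢(EuclideanSpace ℝ (Fin d), ℝ) :=
  LineDeriv.lineDerivOp (EuclideanSpace.single i (1 : ℝ)) W

lemma schwartzD_apply (i : Fin d) (z : EuclideanSpace ℝ (Fin d)) :
    schwartzD i W z = fderiv ℝ W z (EuclideanSpace.single i 1) := rfl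

lemma hasFDerivAt_comp_add_smul {g : EuclideanSpace ℝ (Fin d) → ℝ} (hg : Differentiable ℝ g)
    (x z : EuclideanSpace ℝ (Fin d)) (l : ℝ) :
    HasFDerivAt (fun z => g (x + l • z)) (l • fderiv ℝ g (x + l • z)) z := by
  have h1 : HasFDerivAt (fun z : EuclideanSpace ℝ (Fin d) => x + l • z)
      (l • ContinuousLinearMap.id ℝ _) z := ((hasFDerivAt_id z).const_smul l).const_add x
  convert! (hg (x + l • z)).hasFDerivAt.comp z h1 using 1
  ext y; simp

lemma schwartzAvg_partialD (hl : l ≠ 0) (hg : SmoothPeriodic g) (i : Fin d)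
    (x : EuclideanSpace ℝ (Fin d)) :
    schwartzAvg W l (partialD i g) x = -(l⁻¹ * schwartzAvg (schwartzD i W) l g x) := by
  have e : ∀ z, fderiv ℝ (fun z => g (x + l • z)) z (EuclideanSpace.single i 1) =
      l * partialD i g (x + l • z) := fun z => by
    rw [(hasFDerivAt_comp_add_smul hg.differentiable x z l).fderiv]; rfl
  have h := integral_mul_fderiv_eq_neg_fderiv_mul_of_integrable (μ := volume) (𝕜 := ℝ)
    (f := W) (g := fun z => g (x + l • z)) (v := EuclideanSpace.single i 1)
    (hg.integrable_schwartz_mul (schwartzD i W) x l)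
    (by
      simp_rw [e]
      convert! ((hg.deriv i).integrable_schwartz_mul W x l).const_mul l using 2
      ring)
    (hg.integrable_schwartz_mul W x l) (fun z _ => W.differentiableAt)
    (fun z _ => (hasFDerivAt_comp_add_smul hg.differentiable x z l).differentiableAt)
  simp_rw [e] at h
  have h2 : ∫ z, W z * (l * partialD i g (x + l • z)) = l * schwartzAvg W l (partialD i g) x := by
    unfold schwartzAvg
    rw [← integral_const_mul]
    congr with z
    ring
  rw [h2] at h
  change _ = -schwartzAvg (schwartzD i W) l g x at h
  field_simp
  linarith

lemma integrable_schwartz_mul_rpow {α : ℝ} (hα : 0 ≤ α) (hα1 : α ≤ 1) :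
    Integrable (fun z => |W z| * ‖z‖ ^ α) := by
  have h1 := (W.integrable_pow_mul volume 0).add (W.integrable_pow_mul volume 1)
  refine h1.mono' ?_ (.of_forall fun z => ?_)
  · have := Real.continuous_rpow_const hα
    fun_prop
  · have h2 : ‖z‖ ^ α ≤ 1 + ‖z‖ := by
      rcases le_total ‖z‖ 1 with h | h
      · linarith [Real.rpow_le_one (norm_nonneg z) h hα, norm_nonneg z]
      · have := Real.rpow_le_rpow_of_exponent_le h hα1
        rw [Real.rpow_one] at this
        linarith
    rw [norm_mul, Real.norm_eq_abs, abs_abs, Real.norm_of_nonneg (by positivity)]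
    simp only [Pi.add_apply, pow_zero, one_mul, pow_one, Real.norm_eq_abs]
    nlinarith [abs_nonneg (W z)]

/-- The `α`-th absolute moment of a Schwartz function. -/
noncomputable def schwartzMoment (W : 𝓢(EuclideanSpace ℝ (Fin d), ℝ)) (α : ℝ) : ℝ :=
  ∫ z, |W z| * ‖z‖ ^ α

lemma schwartzMoment_nonneg (α : ℝ) : 0 ≤ schwartzMoment W α :=
  integral_nonneg fun z => by positivity

lemma schwartzAvg_abs_sub_le {α M : ℝ} (hα : 0 < α) (hα1 : α ≤ 1)
    {g : EuclideanSpace ℝ (Fin d) → ℝ} (hg : Continuous g) {C : ℝ} (hC : ∀ x, |g x| ≤ C)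
    (hM : ∀ x y, |g x - g y| ≤ M * ‖x - y‖ ^ α) (l m : ℝ) (x : EuclideanSpace ℝ (Fin d)) :
    |schwartzAvg W l g x - schwartzAvg W m g x| ≤ schwartzMoment W α * (M * |l - m| ^ α) := by
  unfold schwartzAvg schwartzMoment
  rw [← integral_sub (integrable_schwartz_mul_of_bounded W hg hC x l)
    (integrable_schwartz_mul_of_bounded W hg hC x m), ← Real.norm_eq_abs, ← integral_mul_const]
  refine norm_integral_le_of_norm_le
    ((integrable_schwartz_mul_rpow W hα.le hα1).mul_const _) (.of_forall fun z => ?_)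
  rw [← mul_sub, norm_mul, Real.norm_eq_abs, Real.norm_eq_abs, mul_assoc]
  gcongr
  refine (hM _ _).trans (le_of_eq ?_)
  rw [add_sub_add_left_eq_sub, ← sub_smul, norm_smul, Real.norm_eq_abs,
    Real.mul_rpow (abs_nonneg _) (norm_nonneg _)]
  ring

lemma schwartzAvg_zero_left (x : EuclideanSpace ℝ (Fin d)) :
    schwartzAvg W 0 g x = (∫ z, W z) * g x := by
  simp [schwartzAvg, integral_mul_const]

lemma schwartzAvg_abs_partialD_le (hl : 0 < l) (hg : SmoothPeriodic g) (i : Fin d) {C : ℝ}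
    (hC : ∀ x, |g x| ≤ C) (x : EuclideanSpace ℝ (Fin d)) :
    |schwartzAvg W l (partialD i g) x| ≤ l⁻¹ * ((∫ z, |schwartzD i W z|) * C) := by
  rw [schwartzAvg_partialD W hl.ne' hg, abs_neg, abs_mul, abs_of_pos (inv_pos.2 hl),
    ← integral_mul_const]
  refine mul_le_mul_of_nonneg_left ?_ (by positivity)
  have hint : Integrable (fun z => |schwartzD i W z| * C) :=
    (schwartzD i W).integrable.abs.mul_const C
  rw [← Real.norm_eq_abs, schwartzAvg]
  refine norm_integral_le_of_norm_le hint (.of_forall fun z => ?_)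
  rw [norm_mul, Real.norm_eq_abs, Real.norm_eq_abs]
  gcongr
  exact hC _

lemma schwartzAvg_abs_partialD_three_le {α M : ℝ} (hα : 0 < α) (hα1 : α ≤ 1) (hl : 0 < l)
    (hg : SmoothPeriodic g) (hM : ∀ x y, |g x - g y| ≤ M * ‖x - y‖ ^ α) (i j k : Fin d)
    (x : EuclideanSpace ℝ (Fin d)) :
    |schwartzAvg W l (partialD i (partialD j (partialD k g))) x| ≤
      schwartzMoment (schwartzD k (schwartzD j (schwartzD i W))) α * M * l ^ (α - 3) := by
  set V := schwartzD k (schwartzD j (schwartzD i W)) with hV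
  have hform : ∀ {g : EuclideanSpace ℝ (Fin d) → ℝ}, SmoothPeriodic g →
      schwartzAvg W l (partialD i (partialD j (partialD k g))) x =
        -(l⁻¹ ^ 3 * schwartzAvg V l g x) := by
    intro g hg
    rw [schwartzAvg_partialD _ hl.ne' ((hg.deriv k).deriv j),
      schwartzAvg_partialD _ hl.ne' (hg.deriv k), schwartzAvg_partialD _ hl.ne' hg]
    ring
  have hV0 : ∫ z, V z = 0 := by
    have h := schwartzAvg_partialD (schwartzD j (schwartzD i W)) one_ne_zero
      (SmoothPeriodic.const 1) k x
    simpa [schwartzAvg, partialD, ← hV] using h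
  obtain ⟨C, -, hC⟩ := hg.exists_bound
  have h := schwartzAvg_abs_sub_le V hα hα1 hg.continuous hC hM l 0 x
  rw [schwartzAvg_zero_left, hV0, zero_mul, sub_zero, sub_zero, abs_of_pos hl] at h
  rw [hform hg, abs_neg, abs_mul, abs_of_pos (by positivity)]
  calc _ ≤ l⁻¹ ^ 3 * (schwartzMoment V α * (M * l ^ α)) := by gcongr
    _ = _ := by
      rw [Real.rpow_sub hl, ← Nat.cast_ofNat (R := ℝ), Real.rpow_natCast]
      field_simp

end schwartzAvg

section TimeDependent

variable {d : ℕ} {I : Set ℝ} {U : ℝ → EuclideanSpace ℝ (Fin d) → ℝ}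

lemma hasFDerivAt_of_contDiffOn_prod_univ (hI : IsOpen I)
    (hU : ContDiffOn ℝ ∞ (fun q : ℝ × EuclideanSpace ℝ (Fin d) => U q.1 q.2) (I ×ˢ univ))
    {r : ℝ} (hr : r ∈ I) (y : EuclideanSpace ℝ (Fin d)) :
    HasFDerivAt (fun q : ℝ × EuclideanSpace ℝ (Fin d) => U q.1 q.2)
      (fderiv ℝ (fun q : ℝ × EuclideanSpace ℝ (Fin d) => U q.1 q.2) (r, y)) (r, y) :=
  ((hU.contDiffAt ((hI.prod isOpen_univ).mem_nhds (mk_mem_prod hr (mem_univ y)))).differentiableAt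
    (by simp)).hasFDerivAt

lemma smoothPeriodic_slice
    (hU : ContDiffOn ℝ ∞ (fun q : ℝ × EuclideanSpace ℝ (Fin d) => U q.1 q.2) (I ×ˢ univ))
    (hper : ∀ t x n, U t (x + latticeVec n) = U t x) {r : ℝ} (hr : r ∈ I) :
    SmoothPeriodic (U r) where
  smooth := by
    have h : ContDiff ℝ ∞ (fun y : EuclideanSpace ℝ (Fin d) => (r, y)) := by fun_prop
    rw [← contDiffOn_univ]
    exact hU.comp h.contDiffOn fun y _ => mk_mem_prod hr (mem_univ y)
  periodic x n := hper r x n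

lemma hasFDerivAt_slice (hI : IsOpen I)
    (hU : ContDiffOn ℝ ∞ (fun q : ℝ × EuclideanSpace ℝ (Fin d) => U q.1 q.2) (I ×ˢ univ))
    {r : ℝ} (hr : r ∈ I) (y : EuclideanSpace ℝ (Fin d)) :
    HasFDerivAt (U r) ((fderiv ℝ (fun q : ℝ × EuclideanSpace ℝ (Fin d) => U q.1 q.2) (r, y)).comp
      (ContinuousLinearMap.inr ℝ ℝ (EuclideanSpace ℝ (Fin d)))) y :=
  (hasFDerivAt_of_contDiffOn_prod_univ hI hU hr y).comp y (hasFDerivAt_prodMk_right r y)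

lemma partialD_slice (hI : IsOpen I)
    (hU : ContDiffOn ℝ ∞ (fun q : ℝ × EuclideanSpace ℝ (Fin d) => U q.1 q.2) (I ×ˢ univ))
    {r : ℝ} (hr : r ∈ I) (y : EuclideanSpace ℝ (Fin d)) (i : Fin d) :
    partialD i (U r) y = fderiv ℝ (fun q : ℝ × EuclideanSpace ℝ (Fin d) => U q.1 q.2) (r, y)
      (0, EuclideanSpace.single i 1) := by
  rw [partialD, (hasFDerivAt_slice hI hU hr y).fderiv]
  simp

lemma hasDerivAt_prodMk_left (r : ℝ) (y : EuclideanSpace ℝ (Fin d)) :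
    HasDerivAt (fun s : ℝ => (s, y)) ((1, 0) : ℝ × EuclideanSpace ℝ (Fin d)) r :=
  (hasDerivAt_id r).prodMk (hasDerivAt_const r y)

lemma hasDerivAt_time (hI : IsOpen I)
    (hU : ContDiffOn ℝ ∞ (fun q : ℝ × EuclideanSpace ℝ (Fin d) => U q.1 q.2) (I ×ˢ univ))
    {r : ℝ} (hr : r ∈ I) (y : EuclideanSpace ℝ (Fin d)) :
    HasDerivAt (fun s => U s y)
      (fderiv ℝ (fun q : ℝ × EuclideanSpace ℝ (Fin d) => U q.1 q.2) (r, y) (1, 0)) r :=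
  HasFDerivAt.comp_hasDerivAt (f := fun s : ℝ => (s, y)) r
    (hasFDerivAt_of_contDiffOn_prod_univ hI hU hr y) (hasDerivAt_prodMk_left r y)

lemma contDiffOn_deriv_time (hI : IsOpen I)
    (hU : ContDiffOn ℝ ∞ (fun q : ℝ × EuclideanSpace ℝ (Fin d) => U q.1 q.2) (I ×ˢ univ)) :
    ContDiffOn ℝ ∞ (fun q : ℝ × EuclideanSpace ℝ (Fin d) => deriv (fun s => U s q.2) q.1)
      (I ×ˢ univ) := by
  have h := (hU.fderiv_of_isOpen (m := ∞) (hI.prod isOpen_univ) (by simp)).clm_apply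
    (contDiffOn_const (c := ((1, 0) : ℝ × EuclideanSpace ℝ (Fin d))))
  exact h.congr fun q hq => (hasDerivAt_time hI hU hq.1 q.2).deriv

/-- Time and space derivatives commute. -/
lemma hasDerivAt_partialD (hI : IsOpen I)
    (hU : ContDiffOn ℝ ∞ (fun q : ℝ × EuclideanSpace ℝ (Fin d) => U q.1 q.2) (I ×ˢ univ))
    {r : ℝ} (hr : r ∈ I) (y : EuclideanSpace ℝ (Fin d)) (i : Fin d) :
    HasDerivAt (fun s => partialD i (U s) y)
      (partialD i (fun z => deriv (fun s => U s z) r) y) r := by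
  set F := fun q : ℝ × EuclideanSpace ℝ (Fin d) => U q.1 q.2
  have hmem : I ×ˢ univ ∈ nhds ((r, y) : ℝ × EuclideanSpace ℝ (Fin d)) :=
    (hI.prod isOpen_univ).mem_nhds (mk_mem_prod hr (mem_univ y))
  have hF : ContDiffAt ℝ ∞ F (r, y) := hU.contDiffAt hmem
  have hd : HasFDerivAt (fderiv ℝ F) (fderiv ℝ (fderiv ℝ F) (r, y)) (r, y) :=
    ((hF.fderiv_right (m := ∞) (by simp)).differentiableAt (by simp)).hasFDerivAt
  have h1 : HasFDerivAt (fun z => deriv (fun s => U s z) r)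
      ((((ContinuousLinearMap.apply ℝ ℝ ((1, 0) : ℝ × EuclideanSpace ℝ (Fin d))).comp
        (fderiv ℝ (fderiv ℝ F) (r, y)))).comp
          (ContinuousLinearMap.inr ℝ ℝ (EuclideanSpace ℝ (Fin d)))) y := by
    have e : (fun z => deriv (fun s => U s z) r) = fun z => fderiv ℝ F (r, z) (1, 0) :=
      funext fun z => (hasDerivAt_time hI hU hr z).deriv
    rw [e]
    exact ((ContinuousLinearMap.apply ℝ ℝ ((1, 0) : ℝ × EuclideanSpace ℝ (Fin d))).hasFDerivAt.comp
      (r, y) hd).comp y (hasFDerivAt_prodMk_right r y)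
  have h2 : HasDerivAt (fun s => partialD i (U s) y)
      (fderiv ℝ (fderiv ℝ F) (r, y) (1, 0) (0, EuclideanSpace.single i 1)) r := by
    have h3 : HasDerivAt (fun s => fderiv ℝ F (s, y) (0, EuclideanSpace.single i 1))
        (fderiv ℝ (fderiv ℝ F) (r, y) (1, 0) (0, EuclideanSpace.single i 1)) r :=
      HasFDerivAt.comp_hasDerivAt (f := fun s : ℝ => (s, y)) r
        ((ContinuousLinearMap.apply ℝ ℝ
          ((0, EuclideanSpace.single i 1) : ℝ × EuclideanSpace ℝ (Fin d))).hasFDerivAt.comp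
          (r, y) hd) (hasDerivAt_prodMk_left r y)
    refine h3.congr_of_eventuallyEq ?_
    filter_upwards [hI.mem_nhds hr] with s hs
    exact partialD_slice hI hU hs y i
  refine h2.congr_deriv ?_
  rw [partialD, h1.fderiv]
  simp only [ContinuousLinearMap.comp_apply, ContinuousLinearMap.inr_apply,
    ContinuousLinearMap.apply_apply]
  exact ((hF.isSymmSndFDerivAt (by
    rw [minSmoothness_of_isRCLikeNormedField]
    exact WithTop.coe_le_coe.2 (le_top (a := (2 : ℕ∞))))) _ _).symm

lemma integral_unitHeatKernel_mul_inner {g : EuclideanSpace ℝ (Fin d) → ℝ} (hg : SmoothPeriodic g)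
    {l : ℝ} (hl : 0 < l) (x : EuclideanSpace ℝ (Fin d)) (i : Fin d) :
    (∫ z, unitHeatKernel d z * (z i * g (x + l • z))) =
      2 * l * schwartzAvg (unitHeatKernel d) l (partialD i g) x := by
  rw [schwartzAvg_partialD _ hl.ne' hg, schwartzAvg]
  have e : ∀ z, unitHeatKernel d z * (z i * g (x + l • z)) =
      (-2) * (schwartzD i (unitHeatKernel d) z * g (x + l • z)) := fun z => by
    rw [schwartzD_apply, lineDerivOp_unitHeatKernel]; ring
  simp_rw [e]
  rw [integral_const_mul]
  field_simp

/-- Differentiation in time of heat averages whose squared scale is an affine function of time. -/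
lemma hasDerivAt_heatAvg (hI : IsOpen I)
    (hU : ContDiffOn ℝ ∞ (fun q : ℝ × EuclideanSpace ℝ (Fin d) => U q.1 q.2) (I ×ˢ univ))
    (hper : ∀ t x n, U t (x + latticeVec n) = U t x) {a b r : ℝ} (hr : r ∈ I)
    (ha : 0 < a + b * r) (x : EuclideanSpace ℝ (Fin d)) :
    HasDerivAt (fun s => schwartzAvg (unitHeatKernel d) (√(a + b * s)) (U s) x)
      (schwartzAvg (unitHeatKernel d) (√(a + b * r))
        (fun y => deriv (fun s => U s y) r + b * ∑ i, partialD i (partialD i (U r)) y) x) r := by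
  set F := fun q : ℝ × EuclideanSpace ℝ (Fin d) => U q.1 q.2 with hFdef
  have hopen : IsOpen (I ∩ {s | 0 < a + b * s}) :=
    hI.inter (isOpen_lt continuous_const (by fun_prop))
  obtain ⟨ε, hε, hJ⟩ := Metric.nhds_basis_closedBall.mem_iff.1 (hopen.mem_nhds ⟨hr, ha⟩)
  set J := Metric.closedBall r ε
  have hJc : IsCompact J := isCompact_closedBall r ε
  have hF' : ContinuousOn (fderiv ℝ F) (I ×ˢ univ) :=
    (hU.fderiv_of_isOpen (m := ∞) (hI.prod isOpen_univ) (by simp)).continuousOn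
  obtain ⟨C, hC0, hC⟩ := exists_norm_le_of_continuousOn_of_periodic hJc (f := fderiv ℝ F)
    (hF'.mono (prod_mono_left fun s hs => (hJ hs).1)) (fun s _ y n => by
      have e : (fun q : ℝ × EuclideanSpace ℝ (Fin d) => F (q + (0, latticeVec n))) = F := by
        ext q
        simp [hFdef, hper]
      have := fderiv_comp_add_right (𝕜 := ℝ) (f := F) (x := (s, y)) (0, latticeVec n)
      rw [e] at this
      simpa using this.symm)
  obtain ⟨C', hC'⟩ := hJc.exists_bound_of_continuousOn (f := fun s => b / (2 * √(a + b * s)))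
    (ContinuousOn.div (by fun_prop) (by fun_prop) fun s hs => by
      have := Real.sqrt_pos.2 (hJ hs).2
      positivity)
  have hC'0 : 0 ≤ C' := (norm_nonneg _).trans (hC' r (Metric.mem_closedBall_self hε.le))
  have hl := Real.sqrt_pos.2 ha
  have hslice : ∀ {s}, s ∈ I → SmoothPeriodic (U s) := fun hs => smoothPeriodic_slice hU hper hs
  have hdt : SmoothPeriodic (fun y => deriv (fun s => U s y) r) :=
    smoothPeriodic_slice (U := fun t y => deriv (fun s => U s y) t) (contDiffOn_deriv_time hI hU)
      (fun t x n => by simp_rw [hper]) hr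
  have hlap : SmoothPeriodic (fun y => ∑ i, partialD i (partialD i (U r)) y) :=
    SmoothPeriodic.sum fun i _ => ((hslice hr).deriv i).deriv i
  let G' : ℝ → EuclideanSpace ℝ (Fin d) → ℝ := fun s z =>
    unitHeatKernel d z * fderiv ℝ F (s, x + √(a + b * s) • z) (1, (b / (2 * √(a + b * s))) • z)
  have hsplit : ∀ s ∈ I, ∀ z, G' s z =
      unitHeatKernel d z * deriv (fun t => U t (x + √(a + b * s) • z)) s +
        b / (2 * √(a + b * s)) * ∑ i, unitHeatKernel d z *
          (z i * partialD i (U s) (x + √(a + b * s) • z)) := by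
    intro s hs z
    have e1 : ((1, (b / (2 * √(a + b * s))) • z) : ℝ × EuclideanSpace ℝ (Fin d)) =
        (1, 0) + (b / (2 * √(a + b * s))) •
          ∑ i, z i • ((0, EuclideanSpace.single i 1) : ℝ × EuclideanSpace ℝ (Fin d)) := by
      have e2 : (∑ i, z i • ((0, EuclideanSpace.single i 1) : ℝ × EuclideanSpace ℝ (Fin d))) =
          (0, z) := by
        refine Prod.ext (by simp [Prod.fst_sum]) ?_
        have := (EuclideanSpace.basisFun (Fin d) ℝ).sum_repr z
        simpa [Prod.snd_sum] using this
      rw [e2]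
      simp
    simp only [G']
    rw [e1, map_add, map_smul, map_sum, (hasDerivAt_time hI hU hs _).deriv]
    simp_rw [map_smul, partialD_slice hI hU hs, ← Finset.mul_sum, smul_eq_mul]
    ring
  have key := hasDerivAt_integral_of_dominated_loc_of_deriv_le (𝕜 := ℝ) (μ := volume)
    (F := fun s z => unitHeatKernel d z * U s (x + √(a + b * s) • z)) (F' := G') (x₀ := r)
    (bound := fun z => C * (‖z‖ ^ 0 * ‖unitHeatKernel d z‖) +
      C * C' * (‖z‖ ^ 1 * ‖unitHeatKernel d z‖))
    (Metric.closedBall_mem_nhds r hε)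
    (by
      filter_upwards [hI.mem_nhds hr] with s hs
      exact ((hslice hs).integrable_schwartz_mul _ x _).aestronglyMeasurable)
    ((hslice hr).integrable_schwartz_mul _ x _)
    (by
      refine Continuous.aestronglyMeasurable ?_
      have e : G' r = _ := funext (hsplit r hr)
      rw [e]
      have h1 := hdt.continuous
      have h2 := fun i => ((hslice hr).deriv i).continuous
      have h3 := fun i => (h2 i).comp (f := fun z : EuclideanSpace ℝ (Fin d) =>
        x + √(a + b * r) • z) (by fun_prop)
      have h4 := h1.comp (f := fun z : EuclideanSpace ℝ (Fin d) =>
        x + √(a + b * r) • z) (by fun_prop)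
      simp only [Function.comp_def] at h3 h4
      fun_prop)
    (by
      refine .of_forall fun z s hs => ?_
      have h1 : ‖((1, (b / (2 * √(a + b * s))) • z) : ℝ × EuclideanSpace ℝ (Fin d))‖ ≤
          1 + C' * ‖z‖ := by
        rw [Prod.norm_def, norm_one, norm_smul]
        have := mul_le_mul_of_nonneg_right (hC' s hs) (norm_nonneg z)
        exact max_le (by nlinarith [norm_nonneg z]) (by linarith)
      calc ‖G' s z‖ ≤ ‖unitHeatKernel d z‖ * (C * (1 + C' * ‖z‖)) := by
            rw [norm_mul]
            gcongr
            exact (ContinuousLinearMap.le_opNorm _ _).trans (by gcongr; exact hC s hs _)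
        _ = _ := by ring)
    (((unitHeatKernel d).integrable_pow_mul volume 0 |>.const_mul C).add
      ((unitHeatKernel d).integrable_pow_mul volume 1 |>.const_mul (C * C')))
    (by
      refine .of_forall fun z s hs => ?_
      refine HasDerivAt.const_mul _ ?_
      have hsq : HasDerivAt (fun s => √(a + b * s)) (b / (2 * √(a + b * s))) s := by
        have h0 : HasDerivAt (fun s => a + b * s) b s := by
          simpa using ((hasDerivAt_id s).const_mul b).const_add a
        exact h0.sqrt (hJ hs).2.ne'
      exact (hasFDerivAt_of_contDiffOn_prod_univ hI hU (hJ hs).1 _).comp_hasDerivAt s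
        ((hasDerivAt_id s).prodMk ((hsq.smul_const z).const_add x)))
  refine key.2.congr_deriv (Eq.symm ?_)
  have e : G' r = _ := funext (hsplit r hr)
  have hint : ∀ i, Integrable (fun z => unitHeatKernel d z *
      (z i * partialD i (U r) (x + √(a + b * r) • z))) := fun i => by
    have := ((hslice hr).deriv i).integrable_schwartz_mul (schwartzD i (unitHeatKernel d)) x
      (√(a + b * r)) |>.const_mul (-2)
    refine this.congr (.of_forall fun z => ?_)
    simp only [schwartzD_apply, lineDerivOp_unitHeatKernel]
    ring
  rw [e, integral_add (hdt.integrable_schwartz_mul _ x _)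
    ((integrable_finsetSum _ fun i _ => hint i).const_mul _), integral_const_mul,
    integral_finsetSum _ fun i _ => hint i]
  simp_rw [integral_unitHeatKernel_mul_inner ((hslice hr).deriv _) hl]
  rw [schwartzAvg_add _ hdt ((SmoothPeriodic.const b).mul hlap)]
  have hb : schwartzAvg (unitHeatKernel d) √(a + b * r)
      (fun y => b * ∑ i, partialD i (partialD i (U r)) y) x =
      b * ∑ i, schwartzAvg (unitHeatKernel d) √(a + b * r) (partialD i (partialD i (U r))) x := by
    rw [← schwartzAvg_sum _ fun i _ => ((hslice hr).deriv i).deriv i]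
    unfold schwartzAvg
    rw [← integral_const_mul]
    congr with z
    ring
  rw [hb, ← Finset.mul_sum]
  have hl' := hl.ne'
  unfold schwartzAvg
  field_simp

end TimeDependent

lemma SmoothPeriodic.hasDerivAt_heatAvg {d : ℕ} {g : EuclideanSpace ℝ (Fin d) → ℝ}
    (hg : SmoothPeriodic g) {a : ℝ} (ha : 0 < a) (x : EuclideanSpace ℝ (Fin d)) :
    HasDerivAt (fun s => schwartzAvg (unitHeatKernel d) √s g x)
      (schwartzAvg (unitHeatKernel d) √a (fun y => ∑ i, partialD i (partialD i g) y) x) a := by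
  have h := _root_.hasDerivAt_heatAvg (U := fun _ => g) isOpen_univ
    (hg.smooth.comp contDiff_snd).contDiffOn (fun _ => hg.periodic) (a := 0) (b := 1) (mem_univ a)
    (by simpa using ha) x
  simpa using h

lemma abs_sub_le_of_abs_deriv_le {f f' B B' : ℝ → ℝ} {a b : ℝ} (hab : a ≤ b)
    (hf : ContinuousOn f (Icc a b)) (hB : ContinuousOn B (Icc a b))
    (hf' : ∀ r ∈ Ioo a b, HasDerivAt f (f' r) r) (hB' : ∀ r ∈ Ioo a b, HasDerivAt B (B' r) r)
    (h : ∀ r ∈ Ioo a b, |f' r| ≤ B' r) : |f b - f a| ≤ B b - B a := by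
  have h1 : MonotoneOn (fun r => B r - f r) (Icc a b) := by
    refine monotoneOn_of_hasDerivWithinAt_nonneg (f' := fun r => B' r - f' r) (convex_Icc a b)
      (hB.sub hf) ?_ ?_ <;> rw [interior_Icc]
    · exact fun r hr => ((hB' r hr).sub (hf' r hr)).hasDerivWithinAt
    · exact fun r hr => sub_nonneg.2 ((le_abs_self _).trans (h r hr))
  have h2 : MonotoneOn (fun r => B r + f r) (Icc a b) := by
    refine monotoneOn_of_hasDerivWithinAt_nonneg (f' := fun r => B' r + f' r) (convex_Icc a b)
      (hB.add hf) ?_ ?_ <;> rw [interior_Icc]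
    · exact fun r hr => ((hB' r hr).add (hf' r hr)).hasDerivWithinAt
    · exact fun r hr => by linarith [(abs_le.1 (h r hr)).1]
  have ha := left_mem_Icc.2 hab
  have hb := right_mem_Icc.2 hab
  have h3 := h1 ha hb hab
  have h4 := h2 ha hb hab
  simp only at h3 h4
  rw [abs_le]
  constructor <;> linarith

section Forcing

variable {d : ℕ} {R : Fin d → Fin d → EuclideanSpace ℝ (Fin d) → ℝ}
  {q : EuclideanSpace ℝ (Fin d) → ℝ} {f : Fin d → EuclideanSpace ℝ (Fin d) → ℝ}

/-- If `f = - div R - ∇ q` is divergence free, the Laplacian of `f` is a combination of third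
derivatives of `R`. -/
lemma laplacian_eq_of_divergence_eq_zero (hR : ∀ i j, SmoothPeriodic (R i j))
    (hq : SmoothPeriodic q)
    (hf : ∀ i, f i = fun x => -(∑ j, partialD j (R j i) x) - partialD i q x)
    (hdiv : ∀ x, ∑ i, partialD i (f i) x = 0) (i : Fin d) :
    (fun x => ∑ k, partialD k (partialD k (f i)) x) = fun x =>
      -(∑ k, ∑ j, partialD k (partialD k (partialD j (R j i))) x) +
        ∑ k, ∑ j, partialD i (partialD k (partialD j (R j k))) x := by
  have hdR : ∀ i, SmoothPeriodic (fun x => ∑ j, partialD j (R j i) x) := fun i =>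
    SmoothPeriodic.sum fun j _ => (hR j i).deriv j
  have hD : ∀ i k, partialD k (f i) =
      fun x => -(∑ j, partialD k (partialD j (R j i)) x) - partialD k (partialD i q) x := by
    intro i k
    rw [hf, SmoothPeriodic.partialD_sub (hdR i).neg (hq.deriv i), SmoothPeriodic.partialD_neg,
      SmoothPeriodic.partialD_sum fun j _ => (hR j i).deriv j]
  have hDD : ∀ k, partialD k (partialD k (f i)) =
      fun x => -(∑ j, partialD k (partialD k (partialD j (R j i))) x) -
        partialD i (partialD k (partialD k q)) x := by
    intro k
    have hs : SmoothPeriodic (fun x => ∑ j, partialD k (partialD j (R j i)) x) :=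
      SmoothPeriodic.sum fun j _ => ((hR j i).deriv j).deriv k
    rw [hD, SmoothPeriodic.partialD_sub hs.neg ((hq.deriv i).deriv k),
      SmoothPeriodic.partialD_neg,
      SmoothPeriodic.partialD_sum fun j _ => ((hR j i).deriv j).deriv k,
      hq.partialD_comm k i, (hq.deriv k).partialD_comm k i]
  have hlap : (fun x => ∑ k, partialD k (partialD k q) x) =
      fun x => -∑ k, ∑ j, partialD k (partialD j (R j k)) x := by
    ext x
    have := hdiv x
    simp_rw [hD, Finset.sum_sub_distrib, Finset.sum_neg_distrib] at this
    linarith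
  have hlap' := congrArg (partialD i) hlap
  rw [SmoothPeriodic.partialD_sum fun k _ => (hq.deriv k).deriv k, SmoothPeriodic.partialD_neg,
    SmoothPeriodic.partialD_sum fun k _ => SmoothPeriodic.sum fun j _ =>
      ((hR j k).deriv j).deriv k] at hlap'
  ext x
  have h := congrFun hlap' x
  simp_rw [SmoothPeriodic.partialD_sum fun j _ => ((hR j _).deriv j).deriv _] at h
  simp_rw [hDD, Finset.sum_sub_distrib, Finset.sum_neg_distrib, h]
  ring

/-- The sum of the `α`-th moments of all third derivatives of the unit heat kernel. -/
noncomputable def heatMoment (d : ℕ) (α : ℝ) : ℝ :=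
  ∑ i : Fin d, ∑ j : Fin d, ∑ k : Fin d,
    schwartzMoment (schwartzD k (schwartzD j (schwartzD i (unitHeatKernel d)))) α

lemma heatMoment_nonneg (d : ℕ) (α : ℝ) : 0 ≤ heatMoment d α :=
  Finset.sum_nonneg fun _ _ => Finset.sum_nonneg fun _ _ => Finset.sum_nonneg fun _ _ =>
    schwartzMoment_nonneg _ _

lemma schwartzMoment_le_heatMoment (α : ℝ) (i j k : Fin d) :
    schwartzMoment (schwartzD k (schwartzD j (schwartzD i (unitHeatKernel d)))) α ≤
      heatMoment d α := by
  have h0 := fun i j k => schwartzMoment_nonneg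
    (schwartzD k (schwartzD j (schwartzD i (unitHeatKernel d)))) α
  refine le_trans ?_ (Finset.single_le_sum (f := fun i => ∑ j : Fin d, ∑ k : Fin d,
    schwartzMoment (schwartzD k (schwartzD j (schwartzD i (unitHeatKernel d)))) α)
    (fun i _ => Finset.sum_nonneg fun _ _ => Finset.sum_nonneg fun _ _ => h0 _ _ _)
    (Finset.mem_univ i))
  refine le_trans ?_ (Finset.single_le_sum (f := fun j => ∑ k : Fin d,
    schwartzMoment (schwartzD k (schwartzD j (schwartzD i (unitHeatKernel d)))) α)
    (fun j _ => Finset.sum_nonneg fun _ _ => h0 _ _ _) (Finset.mem_univ j))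
  exact Finset.single_le_sum (f := fun k =>
    schwartzMoment (schwartzD k (schwartzD j (schwartzD i (unitHeatKernel d)))) α)
    (fun k _ => h0 _ _ _) (Finset.mem_univ k)

variable {α M : ℝ}

lemma heatAvg_laplacian_abs_le (hα : 0 < α) (hα1 : α < 1) (hM0 : 0 ≤ M)
    (hR : ∀ i j, SmoothPeriodic (R i j)) (hq : SmoothPeriodic q)
    (hf : ∀ i, f i = fun x => -(∑ j, partialD j (R j i) x) - partialD i q x)
    (hdiv : ∀ x, ∑ i, partialD i (f i) x = 0)
    (hM : ∀ i j x y, |R i j x - R i j y| ≤ M * ‖x - y‖ ^ α) (i : Fin d) {a : ℝ} (ha : 0 < a)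
    (x : EuclideanSpace ℝ (Fin d)) :
    |schwartzAvg (unitHeatKernel d) √a (fun y => ∑ k, partialD k (partialD k (f i)) y) x| ≤
      2 * d ^ 2 * heatMoment d α * M * a ^ ((α - 3) / 2) := by
  have hl := Real.sqrt_pos.2 ha
  have hs1 : ∀ k j, SmoothPeriodic (partialD k (partialD k (partialD j (R j i)))) := fun k j =>
    (((hR j i).deriv j).deriv k).deriv k
  have hs2 : ∀ k j, SmoothPeriodic (partialD i (partialD k (partialD j (R j k)))) := fun k j =>
    (((hR j k).deriv j).deriv k).deriv i
  have hsum : ∀ {g : Fin d → Fin d → EuclideanSpace ℝ (Fin d) → ℝ} {c : ℝ},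
      (∀ k j, SmoothPeriodic (g k j)) →
      (∀ k j, |schwartzAvg (unitHeatKernel d) √a (g k j) x| ≤ c) →
      |schwartzAvg (unitHeatKernel d) √a (fun y => ∑ k, ∑ j, g k j y) x| ≤ d ^ 2 * c := by
    intro g c hg hc
    rw [schwartzAvg_sum _ fun k _ => SmoothPeriodic.sum fun j _ => hg k j]
    simp_rw [schwartzAvg_sum _ fun j (_ : j ∈ Finset.univ) => hg _ j]
    calc _ ≤ ∑ k : Fin d, ∑ j : Fin d, c :=
          (Finset.abs_sum_le_sum_abs _ _).trans (Finset.sum_le_sum fun k _ =>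
            (Finset.abs_sum_le_sum_abs _ _).trans (Finset.sum_le_sum fun j _ => hc k j))
      _ = _ := by simp; ring
  have hc : ∀ k j l m n, |schwartzAvg (unitHeatKernel d) √a
      (partialD l (partialD m (partialD n (R j k)))) x| ≤
      heatMoment d α * M * a ^ ((α - 3) / 2) := by
    intro k j l m n
    refine (schwartzAvg_abs_partialD_three_le _ hα hα1.le hl (hR j k) (hM j k) l m n x).trans ?_
    rw [Real.sqrt_eq_rpow, ← Real.rpow_mul ha.le, one_div_mul_eq_div]
    gcongr
    exact schwartzMoment_le_heatMoment _ _ _ _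
  rw [laplacian_eq_of_divergence_eq_zero hR hq hf hdiv i, schwartzAvg_add _
    (SmoothPeriodic.sum fun k _ => SmoothPeriodic.sum fun j _ => hs1 k j).neg
    (SmoothPeriodic.sum fun k _ => SmoothPeriodic.sum fun j _ => hs2 k j), schwartzAvg_neg]
  have h1 := hsum hs1 fun k j => hc i j k k j
  have h2 := hsum hs2 fun k j => hc k j i k j
  rw [abs_le] at *
  constructor <;> linarith

end Forcing

section HeatAvg

variable {d : ℕ} {α N : ℝ} {g : EuclideanSpace ℝ (Fin d) → ℝ} {x : EuclideanSpace ℝ (Fin d)}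

lemma heatAvg_abs_sub_le (hα1 : α < 1) (hN0 : 0 ≤ N) (hg : SmoothPeriodic g)
    (hN : ∀ a, 0 < a → |schwartzAvg (unitHeatKernel d) √a
      (fun y => ∑ k, partialD k (partialD k g) y) x| ≤ N * a ^ ((α - 3) / 2))
    {a b : ℝ} (ha : 0 < a) (hab : a ≤ b) :
    |schwartzAvg (unitHeatKernel d) √b g x - schwartzAvg (unitHeatKernel d) √a g x| ≤
      (b - a) * (N * a ^ ((α - 3) / 2)) := by
  have h := abs_sub_le_of_abs_deriv_le (f := fun s => schwartzAvg (unitHeatKernel d) √s g x)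
    (B := fun s => s * (N * a ^ ((α - 3) / 2))) (B' := fun _ => 1 * (N * a ^ ((α - 3) / 2))) hab
    (fun s hs => (hg.hasDerivAt_heatAvg (ha.trans_le hs.1) x).continuousAt.continuousWithinAt)
    (by fun_prop) (fun s hs => hg.hasDerivAt_heatAvg (ha.trans hs.1) x)
    (fun s _ => (hasDerivAt_id s).mul_const _)
    (fun s hs => (hN s (ha.trans hs.1)).trans (by
      rw [one_mul]
      gcongr ?_ * ?_
      exact Real.rpow_le_rpow_of_nonpos ha hs.1.le (by linarith)))
  linarith

lemma heatAvg_abs_le (hα1 : α < 1) (hN0 : 0 ≤ N) (hg : SmoothPeriodic g)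
    (hN : ∀ a, 0 < a → |schwartzAvg (unitHeatKernel d) √a
      (fun y => ∑ k, partialD k (partialD k g) y) x| ≤ N * a ^ ((α - 3) / 2))
    {C : ℝ} (hC : ∀ l, 0 < l → |schwartzAvg (unitHeatKernel d) l g x| ≤ l⁻¹ * C)
    {a : ℝ} (ha : 0 < a) :
    |schwartzAvg (unitHeatKernel d) √a g x| ≤ 2 / (1 - α) * N * a ^ ((α - 1) / 2) := by
  have hα' : 0 < 1 - α := by linarith
  have key : ∀ b, a < b → |schwartzAvg (unitHeatKernel d) √a g x| ≤
      2 / (1 - α) * N * a ^ ((α - 1) / 2) + (√b)⁻¹ * C := by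
    intro b hab
    have h := abs_sub_le_of_abs_deriv_le (f := fun s => schwartzAvg (unitHeatKernel d) √s g x)
      (B := fun s => -(2 / (1 - α) * N) * s ^ ((α - 1) / 2))
      (B' := fun s => -(2 / (1 - α) * N) * ((α - 1) / 2 * s ^ ((α - 1) / 2 - 1))) hab.le
      (fun s hs => (hg.hasDerivAt_heatAvg (ha.trans_le hs.1) x).continuousAt.continuousWithinAt)
      (fun s hs => ((Real.hasDerivAt_rpow_const
        (.inl (ha.trans_le hs.1).ne')).const_mul _).continuousAt.continuousWithinAt)
      (fun s hs => hg.hasDerivAt_heatAvg (ha.trans hs.1) x)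
      (fun s hs => (Real.hasDerivAt_rpow_const (.inl (ha.trans hs.1).ne')).const_mul _)
      (fun s hs => (hN s (ha.trans hs.1)).trans (le_of_eq (by
        rw [show (α - 1) / 2 - 1 = (α - 3) / 2 by ring]
        field_simp
        ring)))
    have h1 := hC √b (Real.sqrt_pos.2 (ha.trans hab))
    have h2 : 0 ≤ 2 / (1 - α) * N * b ^ ((α - 1) / 2) := by
      have := Real.rpow_nonneg (ha.trans hab).le ((α - 1) / 2)
      positivity
    have h3 := abs_sub_abs_le_abs_sub (schwartzAvg (unitHeatKernel d) √a g x)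
      (schwartzAvg (unitHeatKernel d) √b g x)
    rw [abs_sub_comm] at h3
    linarith
  have hlim : Filter.Tendsto (fun b => 2 / (1 - α) * N * a ^ ((α - 1) / 2) + (√b)⁻¹ * C)
      Filter.atTop (nhds (2 / (1 - α) * N * a ^ ((α - 1) / 2) + 0 * C)) :=
    ((Real.tendsto_sqrt_atTop.inv_tendsto_atTop).mul_const C).const_add _
  rw [zero_mul, add_zero] at hlim
  exact ge_of_tendsto hlim ((Filter.eventually_gt_atTop a).mono key)

end HeatAvg

lemma continuous_slice_of_continuousOn {E F : Type*} [TopologicalSpace E] [TopologicalSpace F]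
    {T : ℝ} {U : ℝ → E → F} (hcont : ContinuousOn (fun q : ℝ × E => U q.1 q.2) (Ico 0 T ×ˢ univ))
    {r : ℝ} (hr : r ∈ Ico 0 T) : Continuous (U r) := by
  rw [← continuousOn_univ]
  exact hcont.comp (f := fun y : E => (r, y)) (by fun_prop)
    fun y _ => mk_mem_prod hr (mem_univ y)

section Duhamel

variable {d : ℕ} {α T ν M₀ : ℝ} {U : ℝ → EuclideanSpace ℝ (Fin d) → ℝ}

lemma continuousOn_heatAvg
    (hcont : ContinuousOn (fun q : ℝ × EuclideanSpace ℝ (Fin d) => U q.1 q.2)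
      (Ico 0 T ×ˢ univ)) (hbd : ∀ r ∈ Ico 0 T, ∀ y, |U r y| ≤ M₀) (a b : ℝ)
    (x : EuclideanSpace ℝ (Fin d)) :
    ContinuousOn (fun r => schwartzAvg (unitHeatKernel d) √(a + b * r) (U r) x) (Ico 0 T) := by
  refine continuousOn_of_dominated (bound := fun z => ‖unitHeatKernel d z‖ * M₀)
    (fun r hr => ?_) (fun r hr => .of_forall fun z => ?_)
    ((unitHeatKernel d).integrable.norm.mul_const _) (.of_forall fun z => ?_)
  · exact (integrable_schwartz_mul_of_bounded _ (continuous_slice_of_continuousOn hcont hr)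
      (hbd r hr) x _).aestronglyMeasurable
  · rw [norm_mul]
    gcongr
    exact hbd r hr _
  · refine continuousOn_const.mul ?_
    exact hcont.comp (f := fun r : ℝ => (r, x + √(a + b * r) • z)) (by fun_prop)
      fun r hr => mk_mem_prod hr (mem_univ _)

/-- The change over time of the difference between a mollified solution of a forced heat equation
and the heat evolution of its initial datum. -/
lemma heatAvg_abs_sub_sub_le {N : ℝ} (hα1 : α < 1) (hν : 0 < ν) (hN0 : 0 ≤ N)
    (hcont : ContinuousOn (fun q : ℝ × EuclideanSpace ℝ (Fin d) => U q.1 q.2) (Ico 0 T ×ˢ univ))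
    (hbd : ∀ r ∈ Ico 0 T, ∀ y, |U r y| ≤ M₀)
    (hU : ContDiffOn ℝ ∞ (fun q : ℝ × EuclideanSpace ℝ (Fin d) => U q.1 q.2) (Ioo 0 T ×ˢ univ))
    (hper : ∀ t x n, U t (x + latticeVec n) = U t x) {x : EuclideanSpace ℝ (Fin d)}
    {f : ℝ → EuclideanSpace ℝ (Fin d) → ℝ}
    (hf : ∀ r ∈ Ioo 0 T, f r = fun y =>
      deriv (fun s => U s y) r + -ν * ∑ i, partialD i (partialD i (U r)) y)
    (h1 : ∀ r ∈ Ioo 0 T, ∀ a, 0 < a → |schwartzAvg (unitHeatKernel d) √a (f r) x| ≤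
      2 / (1 - α) * N * a ^ ((α - 1) / 2))
    (h2 : ∀ r ∈ Ioo 0 T, ∀ a b, 0 < a → a ≤ b → |schwartzAvg (unitHeatKernel d) √b (f r) x -
      schwartzAvg (unitHeatKernel d) √a (f r) x| ≤ (b - a) * (N * a ^ ((α - 3) / 2)))
    {s t σ : ℝ} (hs : 0 ≤ s) (hst : s ≤ t) (ht : t < T) (hσ : 0 < σ) :
    |(schwartzAvg (unitHeatKernel d) √σ (U t) x -
        schwartzAvg (unitHeatKernel d) √(σ + ν * t) (U 0) x) -
      (schwartzAvg (unitHeatKernel d) √σ (U s) x -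
        schwartzAvg (unitHeatKernel d) √(σ + ν * s) (U 0) x)| ≤
      2 * (2 / (1 - α)) * (t - s) * N * σ ^ ((α - 1) / 2) := by
  have hα' : 0 < 1 - α := by linarith
  set φ : ℝ → ℝ → ℝ := fun t r =>
    schwartzAvg (unitHeatKernel d) √((σ + ν * t) + -ν * r) (U r) x with hφ
  have hφc : ∀ t, ContinuousOn (φ t) (Ico 0 T) := fun t => continuousOn_heatAvg hcont hbd _ _ x
  have hφd : ∀ t r, r ∈ Ioo 0 T → r ≤ t → HasDerivAt (φ t)
      (schwartzAvg (unitHeatKernel d) √((σ + ν * t) + -ν * r) (f r) x) r := by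
    intro t r hr hrt
    rw [hf r hr]
    exact hasDerivAt_heatAvg isOpen_Ioo hU hper hr (by nlinarith) x
  have hdiag : ∀ r, φ r r = schwartzAvg (unitHeatKernel d) √σ (U r) x := fun r => by
    simp only [hφ]; ring_nf
  have hzero : ∀ r, φ r 0 = schwartzAvg (unitHeatKernel d) √(σ + ν * r) (U 0) x := fun r => by
    simp only [hφ]; ring_nf
  have e1 : |φ t t - φ t s| ≤ (t - s) * (2 / (1 - α) * N * σ ^ ((α - 1) / 2)) := by
    have h := abs_sub_le_of_abs_deriv_le (f := φ t)
      (B := fun r => r * (2 / (1 - α) * N * σ ^ ((α - 1) / 2)))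
      (B' := fun _ => 1 * (2 / (1 - α) * N * σ ^ ((α - 1) / 2))) hst
      ((hφc t).mono fun r hr => ⟨hs.trans hr.1, hr.2.trans_lt ht⟩) (by fun_prop)
      (fun r hr => hφd t r ⟨hs.trans_lt hr.1, hr.2.trans ht⟩ hr.2.le)
      (fun r _ => (hasDerivAt_id r).mul_const _)
      (fun r hr => (h1 r ⟨hs.trans_lt hr.1, hr.2.trans ht⟩ _ (by nlinarith [hr.2])).trans (by
        rw [one_mul]
        gcongr ?_ * ?_
        exact Real.rpow_le_rpow_of_nonpos hσ (by nlinarith [hr.2]) (by linarith)))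
    linarith
  have e2 : |(φ t s - φ s s) - (φ t 0 - φ s 0)| ≤
      (t - s) * (2 / (1 - α) * N * σ ^ ((α - 1) / 2)) := by
    have hpos : ∀ r, r ≤ s → 0 < (σ + ν * s) + -ν * r := fun r hr => by nlinarith
    have hBd : ∀ r ≤ s, HasDerivAt
        (fun r => (t - s) * (2 / (1 - α) * N) * ((σ + ν * s) + -ν * r) ^ ((α - 1) / 2))
        ((t - s) * (2 / (1 - α) * N) *
          (-ν * ((α - 1) / 2) * ((σ + ν * s) + -ν * r) ^ ((α - 1) / 2 - 1))) r := by
      intro r hr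
      have h0 : HasDerivAt (fun r => (σ + ν * s) + -ν * r) (-ν) r := by
        simpa using ((hasDerivAt_id r).const_mul (-ν)).const_add (σ + ν * s)
      exact (h0.rpow_const (.inl (hpos r hr).ne')).const_mul _
    have h := abs_sub_le_of_abs_deriv_le (f := fun r => φ t r - φ s r) hs
      (((hφc t).sub (hφc s)).mono fun r hr => ⟨hr.1, (hr.2.trans hst).trans_lt ht⟩)
      (fun r hr => (hBd r hr.2).continuousAt.continuousWithinAt)
      (fun r hr => (hφd t r ⟨hr.1, (hr.2.trans_le hst).trans ht⟩ (hr.2.le.trans hst)).sub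
        (hφd s r ⟨hr.1, (hr.2.trans_le hst).trans ht⟩ hr.2.le))
      (fun r hr => hBd r hr.2.le)
      (fun r hr => (h2 r ⟨hr.1, (hr.2.trans_le hst).trans ht⟩ _ _ (hpos r hr.2.le)
        (by nlinarith)).trans (le_of_eq (by
          rw [show (α - 1) / 2 - 1 = (α - 3) / 2 by ring]
          field_simp
          ring)))
    have h3 : 0 ≤ (t - s) * (2 / (1 - α) * N) * ((σ + ν * s) + -ν * 0) ^ ((α - 1) / 2) := by
      have := Real.rpow_nonneg (hpos 0 hs).le ((α - 1) / 2)
      have := sub_nonneg.2 hst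
      positivity
    have h4 : (σ + ν * s) + -ν * s = σ := by ring
    rw [h4] at h
    linarith
  rw [← hdiag, ← hdiag, ← hzero, ← hzero]
  have h := abs_add_le (φ t t - φ t s) ((φ t s - φ s s) - (φ t 0 - φ s 0))
  rw [show (φ t t - φ t 0) - (φ s s - φ s 0) =
    (φ t t - φ t s) + ((φ t s - φ s s) - (φ t 0 - φ s 0)) by ring]
  linarith

end Duhamel

/-- Mollifying at scale `√σ` changes a difference from the heat evolution of the initial datum by
a controlled amount. -/
lemma heatAvg_abs_sub_mollified_le {d : ℕ} {α M₁ C : ℝ} (hα : 0 < α) (hα1 : α ≤ 1) (hM₁ : 0 ≤ M₁)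
    {g₀ g : EuclideanSpace ℝ (Fin d) → ℝ} (hg₀ : Continuous g₀) (hg : Continuous g)
    (hC₀ : ∀ x, |g₀ x| ≤ C) (hC : ∀ x, |g x| ≤ C)
    (hM₀' : ∀ x y, |g₀ x - g₀ y| ≤ M₁ * ‖x - y‖ ^ α)
    (hM' : ∀ x y, |g x - g y| ≤ M₁ * ‖x - y‖ ^ α) {σ τ : ℝ} (hσ : 0 ≤ σ) (hτ : 0 ≤ τ)
    (x : EuclideanSpace ℝ (Fin d)) :
    |(g x - schwartzAvg (unitHeatKernel d) √τ g₀ x) -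
      (schwartzAvg (unitHeatKernel d) √σ g x - schwartzAvg (unitHeatKernel d) √(σ + τ) g₀ x)| ≤
      2 * (schwartzMoment (unitHeatKernel d) α * (M₁ * √σ ^ α)) := by
  have h1 := schwartzAvg_abs_sub_le (unitHeatKernel d) hα hα1 hg hC hM' 0 √σ x
  have h2 := schwartzAvg_abs_sub_le (unitHeatKernel d) hα hα1 hg₀ hC₀ hM₀' √(σ + τ) √τ x
  rw [schwartzAvg_zero_left, integral_unitHeatKernel, one_mul, zero_sub, abs_neg,
    abs_of_nonneg (Real.sqrt_nonneg σ)] at h1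
  have h3 : |√(σ + τ) - √τ| ≤ √σ := by
    rw [abs_of_nonneg (sub_nonneg.2 (Real.sqrt_le_sqrt (by linarith)))]
    have : √(σ + τ) ≤ √σ + √τ := Real.sqrt_le_iff.2 ⟨by positivity, by
      nlinarith [Real.sq_sqrt hσ, Real.sq_sqrt hτ, Real.sqrt_nonneg σ, Real.sqrt_nonneg τ]⟩
    linarith
  have h4 : schwartzMoment (unitHeatKernel d) α * (M₁ * |√(σ + τ) - √τ| ^ α) ≤
      schwartzMoment (unitHeatKernel d) α * (M₁ * √σ ^ α) := by
    have := schwartzMoment_nonneg (unitHeatKernel d) α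
    gcongr
  have h5 := abs_add_le (g x - schwartzAvg (unitHeatKernel d) √σ g x)
    (schwartzAvg (unitHeatKernel d) √(σ + τ) g₀ x - schwartzAvg (unitHeatKernel d) √τ g₀ x)
  rw [show (g x - schwartzAvg (unitHeatKernel d) √τ g₀ x) - (schwartzAvg (unitHeatKernel d) √σ g x -
    schwartzAvg (unitHeatKernel d) √(σ + τ) g₀ x) = (g x - schwartzAvg (unitHeatKernel d) √σ g x) +
    (schwartzAvg (unitHeatKernel d) √(σ + τ) g₀ x - schwartzAvg (unitHeatKernel d) √τ g₀ x) by ring]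
  linarith

section NavierStokes

variable {d : ℕ} {α T ν M₀ M₁ : ℝ}
  {p : ℝ → EuclideanSpace ℝ (Fin d) → ℝ}

/-- The momentum equation in divergence form. -/
lemma forcing_eq {U : ℝ → Fin d → EuclideanSpace ℝ (Fin d) → ℝ} {r : ℝ}
    (hU : ∀ i, SmoothPeriodic (U r i))
    (hNS : ∀ x i, deriv (fun s => U s i x) r + ∑ j, U r j x * partialD j (U r i) x +
      partialD i (p r) x = ν * ∑ j, partialD j (partialD j (U r i)) x)
    (hdiv : ∀ x, ∑ i, partialD i (U r i) x = 0) (i : Fin d) :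
    (fun y => deriv (fun s => U s i y) r + -ν * ∑ j, partialD j (partialD j (U r i)) y) =
      fun x => -(∑ j, partialD j (fun y => U r j y * U r i y) x) - partialD i (p r) x := by
  ext x
  simp_rw [fun j => (hU j).partialD_mul (hU i) j, Finset.sum_add_distrib, ← Finset.sum_mul,
    hdiv x, zero_mul, zero_add]
  linarith [hNS x i]

lemma divergence_forcing_eq_zero {U : ℝ → Fin d → EuclideanSpace ℝ (Fin d) → ℝ}
    (hU : ∀ i, ContDiffOn ℝ ∞ (fun q : ℝ × EuclideanSpace ℝ (Fin d) => U q.1 i q.2)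
      (Ioo 0 T ×ˢ univ))
    (hper : ∀ i t x n, U t i (x + latticeVec n) = U t i x)
    (hdiv : ∀ r ∈ Ioo 0 T, ∀ x, ∑ i, partialD i (U r i) x = 0) {r : ℝ} (hr : r ∈ Ioo 0 T)
    (x : EuclideanSpace ℝ (Fin d)) :
    ∑ i, partialD i (fun y => deriv (fun s => U s i y) r +
      -ν * ∑ j, partialD j (partialD j (U r i)) y) x = 0 := by
  have hs : ∀ i, SmoothPeriodic (U r i) := fun i =>
    smoothPeriodic_slice (U := fun t => U t i) (hU i) (hper i) hr
  have hdt : ∀ i, SmoothPeriodic (fun y => deriv (fun s => U s i y) r) := fun i =>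
    smoothPeriodic_slice (U := fun t y => deriv (fun s => U s i y) t)
      (contDiffOn_deriv_time (U := fun t => U t i) isOpen_Ioo (hU i))
      (fun t x n => by simp_rw [hper]) hr
  have hlap : ∀ i, SmoothPeriodic (fun y => ∑ j, partialD j (partialD j (U r i)) y) := fun i =>
    SmoothPeriodic.sum fun j _ => ((hs i).deriv j).deriv j
  have h1 : ∑ i, partialD i (fun y => deriv (fun s => U s i y) r) x = 0 := by
    have h := HasDerivAt.fun_sum (u := Finset.univ) fun i _ =>
      hasDerivAt_partialD (U := fun t => U t i) isOpen_Ioo (hU i) hr x i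
    refine h.unique ((hasDerivAt_const r (0 : ℝ)).congr_of_eventuallyEq ?_)
    filter_upwards [isOpen_Ioo.mem_nhds hr] with s hs
    exact hdiv s hs x
  have h2 : ∀ i, partialD i (fun y => deriv (fun s => U s i y) r +
      -ν * ∑ j, partialD j (partialD j (U r i)) y) x =
      partialD i (fun y => deriv (fun s => U s i y) r) x +
        -ν * ∑ j, partialD j (partialD j (partialD i (U r i))) x := by
    intro i
    have h3 : ∀ j, partialD i (partialD j (partialD j (U r i))) =
        partialD j (partialD j (partialD i (U r i))) := fun j => by
      rw [((hs i).deriv j).partialD_comm, (hs i).partialD_comm i j]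
    rw [(hdt i).partialD_add ((SmoothPeriodic.const (-ν)).mul (hlap i)),
      (SmoothPeriodic.const (-ν)).partialD_mul (hlap i),
      SmoothPeriodic.partialD_sum fun j _ => ((hs i).deriv j).deriv j]
    simp [h3, partialD_const]
  have h4 : ∀ j, ∑ i, partialD j (partialD j (partialD i (U r i))) x = 0 := by
    intro j
    have h5 : (fun x => ∑ i, partialD i (U r i) x) = fun _ => 0 := funext (hdiv r hr)
    have h6 := congrArg (fun g => partialD j (partialD j g) x) h5
    rw [SmoothPeriodic.partialD_sum fun i _ => (hs i).deriv i,
      SmoothPeriodic.partialD_sum fun i _ => ((hs i).deriv i).deriv j,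
      partialD_const, partialD_const] at h6
    exact h6
  simp_rw [h2, Finset.sum_add_distrib, h1, ← Finset.mul_sum]
  rw [Finset.sum_comm]
  simp [h4]

/-- The temporal estimate for one component, at every mollification scale. -/
lemma component_abs_sub_le {U : ℝ → Fin d → EuclideanSpace ℝ (Fin d) → ℝ}
    (hα : 0 < α) (hα1 : α < 1) (hν : 0 < ν) (hM₀ : 0 ≤ M₀) (hM₁ : 0 ≤ M₁)
    (hcont : ∀ i, ContinuousOn (fun q : ℝ × EuclideanSpace ℝ (Fin d) => U q.1 i q.2)
      (Ico 0 T ×ˢ univ))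
    (hU : ∀ i, ContDiffOn ℝ ∞ (fun q : ℝ × EuclideanSpace ℝ (Fin d) => U q.1 i q.2)
      (Ioo 0 T ×ˢ univ))
    (hp : ContDiffOn ℝ ∞ (fun q : ℝ × EuclideanSpace ℝ (Fin d) => p q.1 q.2) (Ioo 0 T ×ˢ univ))
    (hper : ∀ i t x n, U t i (x + latticeVec n) = U t i x)
    (hpper : ∀ t x n, p t (x + latticeVec n) = p t x)
    (hNS : ∀ r ∈ Ioo 0 T, ∀ x i, deriv (fun s => U s i x) r +
      ∑ j, U r j x * partialD j (U r i) x + partialD i (p r) x =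
        ν * ∑ j, partialD j (partialD j (U r i)) x)
    (hdiv : ∀ r ∈ Ioo 0 T, ∀ x, ∑ i, partialD i (U r i) x = 0)
    (hbd : ∀ r ∈ Ico 0 T, ∀ i x, |U r i x| ≤ M₀)
    (hhol : ∀ r ∈ Ico 0 T, ∀ i x y, |U r i x - U r i y| ≤ M₁ * ‖x - y‖ ^ α)
    (i : Fin d) (x : EuclideanSpace ℝ (Fin d)) {s t σ : ℝ} (hs : 0 ≤ s) (hst : s ≤ t) (ht : t < T)
    (hσ : 0 < σ) :
    |(U t i x - schwartzAvg (unitHeatKernel d) √(ν * t) (U 0 i) x) -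
      (U s i x - schwartzAvg (unitHeatKernel d) √(ν * s) (U 0 i) x)| ≤
      4 * (schwartzMoment (unitHeatKernel d) α * (M₁ * √σ ^ α)) +
        2 * (2 / (1 - α)) * (t - s) * (2 * d ^ 2 * heatMoment d α * (2 * M₀ * M₁)) *
          σ ^ ((α - 1) / 2) := by
  have hN0 : 0 ≤ 2 * d ^ 2 * heatMoment d α * (2 * M₀ * M₁) := by
    have := heatMoment_nonneg d α
    positivity
  have hslice : ∀ {r}, r ∈ Ioo 0 T → ∀ i, SmoothPeriodic (U r i) := fun hr i =>
    smoothPeriodic_slice (U := fun t => U t i) (hU i) (hper i) hr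
  have hpr : ∀ {r}, r ∈ Ioo 0 T → SmoothPeriodic (p r) := fun hr =>
    smoothPeriodic_slice hp hpper hr
  set f : ℝ → Fin d → EuclideanSpace ℝ (Fin d) → ℝ := fun r i y =>
    deriv (fun s => U s i y) r + -ν * ∑ j, partialD j (partialD j (U r i)) y with hf
  have hfeq : ∀ {r}, r ∈ Ioo 0 T → ∀ i, f r i = fun x =>
      -(∑ j, partialD j (fun y => U r j y * U r i y) x) - partialD i (p r) x := fun hr i =>
    forcing_eq (hslice hr) (hNS _ hr) (hdiv _ hr) i
  have hR : ∀ {r}, r ∈ Ioo 0 T → ∀ j k, SmoothPeriodic (fun y => U r j y * U r k y) :=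
    fun hr j k => (hslice hr j).mul (hslice hr k)
  have hRsum : ∀ {r}, r ∈ Ioo 0 T →
      SmoothPeriodic (fun x => ∑ j, partialD j (fun y => U r j y * U r i y) x) := fun hr =>
    SmoothPeriodic.sum fun j _ => (hR hr j i).deriv j
  have hfs : ∀ {r}, r ∈ Ioo 0 T → SmoothPeriodic (f r i) := fun hr => by
    rw [hfeq hr i]
    exact (hRsum hr).neg.sub ((hpr hr).deriv i)
  have hRM : ∀ {r}, r ∈ Ioo 0 T → ∀ j k x y,
      |U r j x * U r k x - U r j y * U r k y| ≤ 2 * M₀ * M₁ * ‖x - y‖ ^ α := by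
    intro r hr j k x y
    have hr' := Ioo_subset_Ico_self hr
    have h1 := abs_add_le (U r j x * (U r k x - U r k y)) ((U r j x - U r j y) * U r k y)
    rw [show U r j x * (U r k x - U r k y) + (U r j x - U r j y) * U r k y =
      U r j x * U r k x - U r j y * U r k y by ring, abs_mul, abs_mul] at h1
    have h2 := mul_le_mul (hbd r hr' j x) (hhol r hr' k x y) (abs_nonneg _) hM₀
    have h3 := mul_le_mul (hhol r hr' j x y) (hbd r hr' k y) (abs_nonneg _) (by positivity)
    linarith
  have hN : ∀ r ∈ Ioo 0 T, ∀ a, 0 < a → |schwartzAvg (unitHeatKernel d) √a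
      (fun y => ∑ k, partialD k (partialD k (f r i)) y) x| ≤
      2 * d ^ 2 * heatMoment d α * (2 * M₀ * M₁) * a ^ ((α - 3) / 2) := fun r hr a ha =>
    heatAvg_laplacian_abs_le hα hα1 (by positivity) (hR hr) (hpr hr) (hfeq hr)
      (divergence_forcing_eq_zero hU hper hdiv hr) (hRM hr) i ha x
  have hdecay : ∀ r ∈ Ioo 0 T, ∃ C, ∀ l, 0 < l →
      |schwartzAvg (unitHeatKernel d) l (f r i) x| ≤ l⁻¹ * C := by
    intro r hr
    obtain ⟨P, -, hP⟩ := (hpr hr).exists_bound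
    refine ⟨(∑ j, (∫ z, |schwartzD j (unitHeatKernel d) z|) * (M₀ * M₀)) +
      (∫ z, |schwartzD i (unitHeatKernel d) z|) * P, fun l hl => ?_⟩
    have e : f r i = fun x => -(∑ j, partialD j (fun y => U r j y * U r i y) x) +
        -partialD i (p r) x := hfeq hr i
    rw [e, schwartzAvg_add _ (hRsum hr).neg ((hpr hr).deriv i).neg, schwartzAvg_neg,
      schwartzAvg_neg, schwartzAvg_sum _ fun j _ => (hR hr j i).deriv j]
    refine (abs_add_le _ _).trans ?_
    rw [abs_neg, abs_neg, mul_add, Finset.mul_sum]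
    refine add_le_add ((Finset.abs_sum_le_sum_abs _ _).trans (Finset.sum_le_sum fun j _ =>
      schwartzAvg_abs_partialD_le _ hl (hR hr j i) j (fun y => ?_) x))
      (schwartzAvg_abs_partialD_le _ hl (hpr hr) i hP x)
    have hr' := Ioo_subset_Ico_self hr
    rw [abs_mul]
    exact mul_le_mul (hbd r hr' j y) (hbd r hr' i y) (abs_nonneg _) hM₀
  have hT : (0 : ℝ) ∈ Ico 0 T := ⟨le_rfl, hs.trans_lt (hst.trans_lt ht)⟩
  have hmoll : ∀ r ∈ Ico 0 T, _ := fun r hr =>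
    heatAvg_abs_sub_mollified_le hα hα1.le hM₁
      (continuous_slice_of_continuousOn (U := fun t => U t i) (hcont i) hT)
      (continuous_slice_of_continuousOn (U := fun t => U t i) (hcont i) hr)
      (hbd 0 hT i) (hbd r hr i) (hhol 0 hT i) (hhol r hr i) hσ.le (mul_nonneg hν.le hr.1) x
  have hD := heatAvg_abs_sub_sub_le (U := fun t => U t i) (f := fun r => f r i) (x := x) hα1 hν hN0
    (hcont i) (fun r hr => hbd r hr i) (hU i) (hper i) (fun r _ => rfl)
    (fun r hr a ha => by
      obtain ⟨C, hC⟩ := hdecay r hr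
      exact heatAvg_abs_le hα1 hN0 (hfs hr) (hN r hr) hC ha)
    (fun r hr a b ha hab => heatAvg_abs_sub_le hα1 hN0 (hfs hr) (hN r hr) ha hab)
    hs hst ht hσ
  have ht' := hmoll t ⟨hs.trans hst, ht⟩
  have hs' := hmoll s ⟨hs, hst.trans_lt ht⟩
  rw [abs_le] at *
  constructor <;> linarith [hD.1, hD.2, ht'.1, ht'.2, hs'.1, hs'.2]

end NavierStokes

/-- viscosity-independent Eulerian temporal Hölder estimate for
`ũ(t,x) = u(t,x) − (G_(νt) * u(0,·))(x)`. -/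
theorem stmt0 (d : ℕ) (hd : 2 ≤ d) (α : ℝ) (hα : 0 < α) (hα1 : α < 1) :
    ∃ C : ℝ, 0 < C ∧
      ∀ T ν : ℝ, 0 < T → 0 < ν →
      ∀ (u : ℝ → EuclideanSpace ℝ (Fin d) → EuclideanSpace ℝ (Fin d)) (p : ℝ → EuclideanSpace ℝ (Fin d) → ℝ),
        ContinuousOn (fun q : ℝ × EuclideanSpace ℝ (Fin d) => u q.1 q.2) (Ico 0 T ×ˢ univ) →
        ContDiffOn ℝ (⊤ : ℕ∞) (fun q : ℝ × EuclideanSpace ℝ (Fin d) => u q.1 q.2) (Ioo 0 T ×ˢ univ) →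
        ContDiffOn ℝ (⊤ : ℕ∞) (fun q : ℝ × EuclideanSpace ℝ (Fin d) => p q.1 q.2) (Ioo 0 T ×ˢ univ) →
        (∀ (t : ℝ) (x : EuclideanSpace ℝ (Fin d)) (n : Fin d → ℤ), u t (x + (EuclideanSpace.equiv (Fin d) ℝ).symm (fun i => (n i : ℝ))) = u t x) →
        (∀ (t : ℝ) (x : EuclideanSpace ℝ (Fin d)) (n : Fin d → ℤ), p t (x + (EuclideanSpace.equiv (Fin d) ℝ).symm (fun i => (n i : ℝ))) = p t x) →
        (∀ t ∈ Ioo (0 : ℝ) T, ∀ (x : EuclideanSpace ℝ (Fin d)) (i : Fin d),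
          deriv (fun s => u s x i) t
              + ∑ j, u t x j * fderiv ℝ (fun y => u t y i) x (EuclideanSpace.single j 1)
              + fderiv ℝ (fun y => p t y) x (EuclideanSpace.single i 1)
            = ν * ∑ j, fderiv ℝ (fun y => fderiv ℝ (fun z => u t z i) y
                (EuclideanSpace.single j 1)) x (EuclideanSpace.single j 1)) →
        (∀ t ∈ Ioo (0 : ℝ) T, ∀ x : EuclideanSpace ℝ (Fin d),
          ∑ i, fderiv ℝ (fun y => u t y i) x (EuclideanSpace.single i 1) = 0) →
        ∀ M₀ M₁ : ℝ,
          (∀ t ∈ Ico (0 : ℝ) T, ∀ x, ‖u t x‖ ≤ M₀) →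
          (∀ t ∈ Ico (0 : ℝ) T, ∀ x y, ‖u t x - u t y‖ ≤ M₁ * ‖x - y‖ ^ α) →
          ∀ utilde : ℝ → EuclideanSpace ℝ (Fin d) → EuclideanSpace ℝ (Fin d),
            (∀ x, utilde 0 x = 0) →
            (∀ t ∈ Ioo (0 : ℝ) T, ∀ x,
              utilde t x = u t x - ∫ y, heatKernel d (ν * t) y • u 0 (x - y)) →
            ∀ (x : EuclideanSpace ℝ (Fin d)) (s t : ℝ), 0 ≤ s → s ≤ t → t < T →
              ‖utilde t x - utilde s x‖ ≤ C * M₀ ^ α * M₁ * (t - s) ^ α := by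
  have hc1 := schwartzMoment_nonneg (unitHeatKernel d) α
  have hc3 := heatMoment_nonneg d α
  have hα' : 0 < 1 - α := by linarith
  refine ⟨d * (4 * schwartzMoment (unitHeatKernel d) α +
    2 * (2 / (1 - α)) * (4 * d ^ 2 * heatMoment d α)) + 1, by positivity, ?_⟩
  intro T ν hT hν u p hcont hU hp hper hpper hNS hdiv M₀ M₁ hbd hhol utilde hu0 hut x s t hs hst ht
  have h0T : (0 : ℝ) ∈ Ico 0 T := ⟨le_rfl, hT⟩
  have hM₀ : 0 ≤ M₀ := (norm_nonneg _).trans (hbd 0 h0T 0)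
  have hM₁ : 0 ≤ M₁ := by
    have h := (norm_nonneg _).trans (hhol 0 h0T (EuclideanSpace.single ⟨0, by omega⟩ 1) 0)
    simpa using h
  have hproj : ∀ i : Fin d, ContDiff ℝ ∞ (fun v : EuclideanSpace ℝ (Fin d) => v i) := fun i =>
    (EuclideanSpace.proj (𝕜 := ℝ) i).contDiff
  have hcomp : ∀ i, ∀ r ∈ Ico 0 T, utilde r x i =
      u r x i - schwartzAvg (unitHeatKernel d) √(ν * r) (fun y => u 0 y i) x := by
    intro i r hr
    rcases hr.1.eq_or_lt with rfl | hr0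
    · rw [mul_zero, Real.sqrt_zero, schwartzAvg_zero_left, integral_unitHeatKernel, hu0]
      simp
    · have hl := Real.sqrt_pos.2 (mul_pos hν hr0)
      have h := integral_heatKernel_smul hl (u 0) x
      rw [Real.sq_sqrt (mul_pos hν hr0).le] at h
      have hc0 : Continuous (u 0) := continuous_slice_of_continuousOn hcont h0T
      have hint : Integrable (fun z => unitHeatKernel d z • u 0 (x + √(ν * r) • z)) :=
        (unitHeatKernel d).integrable.smul_bdd M₀ (by fun_prop)
          (.of_forall fun z => hbd 0 h0T _)
      rw [hut r ⟨hr0, hr.2⟩, h, PiLp.sub_apply]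
      exact congrArg _ ((EuclideanSpace.proj (𝕜 := ℝ) i).integral_comp_comm hint).symm
  have hrhs : 0 ≤ (d * (4 * schwartzMoment (unitHeatKernel d) α +
      2 * (2 / (1 - α)) * (4 * d ^ 2 * heatMoment d α)) + 1) * M₀ ^ α * M₁ * (t - s) ^ α := by
    have := Real.rpow_nonneg (sub_nonneg.2 hst) α
    positivity
  rcases hst.eq_or_lt with rfl | hst'
  · simpa using hrhs
  rcases hM₀.eq_or_lt with rfl | hM₀'
  · have hz : ∀ r ∈ Ico 0 T, ∀ y, u r y = 0 := fun r hr y => by simpa using hbd r hr y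
    have hz' : ∀ r ∈ Ico 0 T, utilde r x = 0 := fun r hr => by
      ext i
      rw [hcomp i r hr, hz r hr]
      simp [hz 0 h0T, schwartzAvg]
    rw [hz' t ⟨hs.trans hst, ht⟩, hz' s ⟨hs, hst.trans_lt ht⟩]
    simpa using hrhs
  have hh : 0 < t - s := sub_pos.2 hst'
  have hMh : 0 < M₀ * (t - s) := mul_pos hM₀' hh
  have hbound : ∀ i, |(utilde t x - utilde s x) i| ≤
      (4 * schwartzMoment (unitHeatKernel d) α +
        2 * (2 / (1 - α)) * (4 * d ^ 2 * heatMoment d α)) * (M₀ ^ α * M₁ * (t - s) ^ α) := by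
    intro i
    have h := component_abs_sub_le (U := fun t i y => u t y i) hα hα1 hν hM₀ hM₁
      (fun i => (hproj i).continuous.comp_continuousOn hcont)
      (fun i => (hproj i).comp_contDiffOn hU) hp (fun i t x n => by rw [latticeVec, hper])
      (fun t x n => hpper t x n) hNS hdiv
      (fun r hr i y => (PiLp.norm_apply_le (u r y) i).trans (hbd r hr y))
      (fun r hr i y z => (PiLp.norm_apply_le (u r y - u r z) i).trans (hhol r hr y z))
      i x hs hst ht (pow_pos hMh 2)
    rw [PiLp.sub_apply, hcomp i t ⟨hs.trans hst, ht⟩, hcomp i s ⟨hs, hst.trans_lt ht⟩]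
    refine h.trans (le_of_eq ?_)
    have e1 : ((M₀ * (t - s)) ^ 2) ^ ((α - 1) / 2) = (M₀ * (t - s)) ^ α / (M₀ * (t - s)) := by
      rw [← Real.rpow_natCast, ← Real.rpow_mul hMh.le, ← Real.rpow_sub_one hMh.ne']
      congr 1
      push_cast
      ring
    rw [Real.sqrt_sq hMh.le, e1, Real.mul_rpow hM₀ hh.le]
    field_simp
    ring
  calc ‖utilde t x - utilde s x‖ ≤ ∑ i, |(utilde t x - utilde s x) i| := by
        conv_lhs => rw [← (EuclideanSpace.basisFun (Fin d) ℝ).sum_repr (utilde t x - utilde s x)]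
        refine (norm_sum_le _ _).trans (le_of_eq (Finset.sum_congr rfl fun i _ => ?_))
        simp [norm_smul]
    _ ≤ ∑ _i : Fin d, (4 * schwartzMoment (unitHeatKernel d) α +
        2 * (2 / (1 - α)) * (4 * d ^ 2 * heatMoment d α)) * (M₀ ^ α * M₁ * (t - s) ^ α) :=
      Finset.sum_le_sum fun i _ => hbound i
    _ = d * (4 * schwartzMoment (unitHeatKernel d) α +
        2 * (2 / (1 - α)) * (4 * d ^ 2 * heatMoment d α)) * (M₀ ^ α * M₁ * (t - s) ^ α) := by
      simp
      ring
    _ ≤ _ := by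
      have : 0 ≤ M₀ ^ α * M₁ * (t - s) ^ α := by positivity
      linarith
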